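/- Let K be a field and F₁, F₂ ∈ K[X₁,X₂,X₃] homogeneous of the same degree j₀. Let P(T₁,T₂,X₁,X₂,X₃) be a bihomogeneous polynomial of bidegree (i,j) with i > 0. Then there exists a polynomial Q(T,X), bihomogeneous of bidegree (i−1, (i−1)j₀ + j), such that F₂(X)^i · P(T,X) − T₂^i · P(F₁(X), F₂(X), X) = (T₁F₂(X) − T₂F₁(X)) · Q(T,X). -/

import Mathlib

open MvPolynomial

/-- Renaming a homogeneous polynomial along `f` is weighted homogeneous when the weight is constant
along `f`. -/
theorem MvPolynomial.IsHomogeneous.isWeightedHomogeneous_rename {σ ι R M : Type*}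
    [CommSemiring R] [AddCommMonoid M] {F : MvPolynomial σ R} {n : ℕ} (hF : F.IsHomogeneous n)
    (f : σ → ι) (w : ι → M) (e : M) (hw : ∀ k, w (f k) = e) :
    (rename f F).IsWeightedHomogeneous w (n • e) := by
  intro d hd
  obtain ⟨u, rfl, hu⟩ := coeff_rename_ne_zero f F d hd
  have h := hF hu
  rw [Finsupp.weight_apply, Finsupp.sum] at h
  rw [Finsupp.weight_apply, Finsupp.sum_mapDomain_index (by simp) (by simp [add_smul]),
    Finsupp.sum, ← h, Finset.sum_smul]
  exact Finset.sum_congr rfl fun k _ => by simp [hw]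

/-- The difference of powers `x ^ a - y ^ a` of weighted homogeneous polynomials of the same degree
has a weighted homogeneous cofactor with respect to `x - y`. -/
theorem MvPolynomial.IsWeightedHomogeneous.exists_pow_sub_pow_eq {σ R M : Type*}
    [CommRing R] [AddCommMonoid M] {w : σ → M} {x y : MvPolynomial σ R} {e : M}
    (hx : x.IsWeightedHomogeneous w e) (hy : y.IsWeightedHomogeneous w e) (a : ℕ) :
    ∃ S : MvPolynomial σ R, S.IsWeightedHomogeneous w ((a - 1) • e) ∧
      x ^ a - y ^ a = (x - y) * S := by
  refine ⟨∑ k ∈ Finset.range a, x ^ k * y ^ (a - 1 - k), ?_, ?_⟩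
  · refine IsWeightedHomogeneous.sum _ _ _ fun k hk => ?_
    have hk' : k + (a - 1 - k) = a - 1 := by
      have := Finset.mem_range.1 hk
      omega
    have hsum := (hx.pow k).mul (hy.pow (a - 1 - k))
    rwa [← add_smul, hk'] at hsum
  · rw [mul_comm, geom_sum₂_mul]

/-- Let `F₁, F₂ ∈ K[X₁,X₂,X₃]` be homogeneous of the same degree `j₀` and let
`P ∈ K[T₁,T₂,X₁,X₂,X₃]` be bihomogeneous of bidegree `(i,j)` with `i > 0`.
Then there is a bihomogeneous `Q` of bidegree `(i−1, (i−1)j₀ + j)` with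
`F₂(X)^i P(T,X) − T₂^i P(F₁(X),F₂(X),X) = (T₁F₂(X) − T₂F₁(X)) Q(T,X)`.
Bihomogeneity is expressed as weighted homogeneity for the weight sending the
`T`-variables to `(1,0)` and the `X`-variables to `(0,1)`. -/
theorem stmt_12 (K : Type*) [Field K] (j₀ i j : ℕ) (hi : 0 < i)
    (F₁ F₂ : MvPolynomial (Fin 3) K)
    (hF₁ : F₁.IsHomogeneous j₀) (hF₂ : F₂.IsHomogeneous j₀)
    (P : MvPolynomial (Fin 2 ⊕ Fin 3) K)
    (hP : P.IsWeightedHomogeneous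
      (Sum.elim (fun _ => ((1 : ℕ), (0 : ℕ))) (fun _ => ((0 : ℕ), (1 : ℕ))))
      (i, j)) :
    let F₁' : MvPolynomial (Fin 2 ⊕ Fin 3) K := rename Sum.inr F₁
    let F₂' : MvPolynomial (Fin 2 ⊕ Fin 3) K := rename Sum.inr F₂
    -- substitution T₁ ↦ F₁(X), T₂ ↦ F₂(X), Xᵢ ↦ Xᵢ
    let τ : MvPolynomial (Fin 2 ⊕ Fin 3) K →ₐ[K] MvPolynomial (Fin 2 ⊕ Fin 3) K :=
      aeval (Sum.elim ![F₁', F₂'] (fun k => X (Sum.inr k)))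
    ∃ Q : MvPolynomial (Fin 2 ⊕ Fin 3) K,
      Q.IsWeightedHomogeneous
        (Sum.elim (fun _ => ((1 : ℕ), (0 : ℕ))) (fun _ => ((0 : ℕ), (1 : ℕ))))
        (i - 1, (i - 1) * j₀ + j) ∧
      F₂' ^ i * P - X (Sum.inl 1) ^ i * τ P =
        (X (Sum.inl 0) * F₂' - X (Sum.inl 1) * F₁') * Q := by
  intro F₁' F₂' τ
  set w : Fin 2 ⊕ Fin 3 → ℕ × ℕ :=
    Sum.elim (fun _ => ((1 : ℕ), (0 : ℕ))) (fun _ => ((0 : ℕ), (1 : ℕ))) with hw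
  have hF₁' : F₁'.IsWeightedHomogeneous w (j₀ • (0, 1)) :=
    hF₁.isWeightedHomogeneous_rename _ _ _ fun _ => rfl
  have hF₂' : F₂'.IsWeightedHomogeneous w (j₀ • (0, 1)) :=
    hF₂.isWeightedHomogeneous_rename _ _ _ fun _ => rfl
  have hT (k : Fin 2) :
      (X (Sum.inl k) : MvPolynomial (Fin 2 ⊕ Fin 3) K).IsWeightedHomogeneous w (1, 0) :=
    isWeightedHomogeneous_X K w (Sum.inl k)
  have hX (k : Fin 3) :
      (X (Sum.inr k) : MvPolynomial (Fin 2 ⊕ Fin 3) K).IsWeightedHomogeneous w (0, 1) :=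
    isWeightedHomogeneous_X K w (Sum.inr k)
  have key : ∀ v : Fin 2 ⊕ Fin 3 →₀ ℕ, ∃ Q : MvPolynomial (Fin 2 ⊕ Fin 3) K,
      v ∈ P.support → Q.IsWeightedHomogeneous w (i - 1, (i - 1) * j₀ + j) ∧
        F₂' ^ i * monomial v (P.coeff v) - X (Sum.inl 1) ^ i * τ (monomial v (P.coeff v)) =
          (X (Sum.inl 0) * F₂' - X (Sum.inl 1) * F₁') * Q := by
    intro v
    by_cases hv : v ∈ P.support
    swap
    · exact ⟨0, fun h => absurd h hv⟩
    have hwt := hP (mem_support_iff.1 hv)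
    rw [Finsupp.weight_apply, Finsupp.sum_fintype _ _ (by simp), Fintype.sum_sum_type,
      Fin.sum_univ_two, Fin.sum_univ_three] at hwt
    simp only [hw, Sum.elim_inl, Sum.elim_inr, Prod.ext_iff, Prod.fst_add, Prod.snd_add,
      Prod.smul_fst, Prod.smul_snd, smul_eq_mul, mul_one, mul_zero, add_zero, zero_add] at hwt
    obtain ⟨hi', hj'⟩ := hwt
    set a := v (Sum.inl 0)
    set b := v (Sum.inl 1)
    set N : MvPolynomial (Fin 2 ⊕ Fin 3) K :=
      C (P.coeff v) * ∏ k : Fin 3, X (Sum.inr k) ^ v (Sum.inr k) with hN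
    have hmon : monomial v (P.coeff v) = X (Sum.inl 0) ^ a * X (Sum.inl 1) ^ b * N := by
      rw [monomial_eq, Finsupp.prod_fintype _ _ (by simp), Fintype.prod_sum_type,
        Fin.prod_univ_two, hN]
      ring
    have hτN : τ N = N := by
      simp [τ, hN, map_prod, algebraMap_eq]
    have hτ : τ (monomial v (P.coeff v)) = F₁' ^ a * F₂' ^ b * N := by
      rw [hmon, map_mul, hτN]
      simp [τ]
    have hNw : N.IsWeightedHomogeneous w (0, j) := by
      have h := (isWeightedHomogeneous_C w (P.coeff v)).mul
        (IsWeightedHomogeneous.prod Finset.univ _ _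
          fun k _ => (hX k).pow (v (Sum.inr k)))
      convert h using 1
      simp [Fin.sum_univ_three, ← hj']
    obtain ha0 | ha0 := Nat.eq_zero_or_pos a
    · refine ⟨0, fun _ => ⟨isWeightedHomogeneous_zero K w _, ?_⟩⟩
      rw [hτ, hmon, ← hi', ha0]
      ring
    obtain ⟨S, hS, hS'⟩ := ((hT 0).mul hF₂').exists_pow_sub_pow_eq ((hT 1).mul hF₁') a
    refine ⟨F₂' ^ b * X (Sum.inl 1) ^ b * N * S, fun _ => ⟨?_, ?_⟩⟩
    · convert (((hF₂'.pow b).mul ((hT 1).pow b)).mul hNw).mul hS using 1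
      have hab : i - 1 = b + (a - 1) := by omega
      rw [hab]
      ext <;> simp
      ring
    · rw [hτ, hmon, ← hi']
      linear_combination (F₂' ^ b * X (Sum.inl 1) ^ b * N) * hS'
  choose Q hQ using key
  refine ⟨∑ v ∈ P.support, Q v, IsWeightedHomogeneous.sum _ _ _ fun v hv => (hQ v hv).1, ?_⟩
  rw [Finset.mul_sum, ← Finset.sum_congr rfl fun v hv => (hQ v hv).2, Finset.sum_sub_distrib,
    ← Finset.mul_sum, ← Finset.mul_sum, ← map_sum, ← as_sum]
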